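/- (Rigidity of linearizable mappings on sequential histories, the key step in the proof of Theorem 4's negative half.) Let h be a complete history in which every index belongs to some matching pair and whose operation calls are pairwise non-overlapping, i.e., for any two distinct matching pairs (m,n) and (m',n') of h, either n < m' or n' < m. If f is a mapping function with VMF(h,f), lin(h,f) and total(h,f), then dom f = dom h and f is the identity on dom h; consequently map(h,f) = h. -/

import Mathlib

/-- Operation names of the stack object. -/
inductive Op where
  | push | pop
  deriving DecidableEq

/-- Values together with the distinguished symbols `⊥` (no input/output) and `empty`. -/
inductive EVal where
  | val : ℕ → EVal
  | bot | empty
  deriving DecidableEq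

/-- Invocation and return events (thread identifier, operation name, input/output value). -/
inductive Event where
  | inv : ℕ → Op → EVal → Event
  | ret : ℕ → Op → EVal → Event
  deriving DecidableEq

/-- The thread of an event. -/
def Event.thread : Event → ℕ
  | .inv t _ _ => t
  | .ret t _ _ => t

/-- `mp m n h`: indices `m < n` form a matching pair in history `h`. -/
def mp (m n : ℕ) (h : List Event) : Prop :=
  m < n ∧ n < h.length ∧
    ∃ t o u v, h[m]? = some (Event.inv t o u) ∧ h[n]? = some (Event.ret t o v) ∧
      ∀ i e, m < i → i < n → h[i]? = some e → e.thread ≠ t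

/-- `pi m h`: index `m` is a pending invocation in history `h`. -/
def pi (m : ℕ) (h : List Event) : Prop :=
  m < h.length ∧ ∀ n, m < n → n < h.length →
    ¬ ∃ t o u v, h[m]? = some (Event.inv t o u) ∧ h[n]? = some (Event.ret t o v)

/-- `VMF h f`: `f` (a partial function on indices, modelled via `Option`) is a valid
mapping function for history `h`. -/
def VMF (h : List Event) (f : ℕ → Option ℕ) : Prop :=
  (∀ m k, f m = some k → m < h.length) ∧
  (∃ n, ∀ k, (∃ m, f m = some k) ↔ k < n) ∧
  (∀ m m' k, f m = some k → f m' = some k → m = m') ∧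
  (∀ m n, mp m n h → ((∃ k, f m = some k) ↔ ∃ k, f n = some k)) ∧
  (∀ m n k, mp m n h → f m = some k → f n = some (k + 1))

/-- `mapped h f g`: `g` is the mapped history `map(h,f)`, i.e. the sequence of length
`|ran f|` whose element at position `f.k` is `h.k`. -/
def mapped (h : List Event) (f : ℕ → Option ℕ) (g : List Event) : Prop :=
  (∀ k, k < g.length ↔ ∃ m, f m = some k) ∧
  (∀ m k, f m = some k → g[k]? = h[m]?)

/-- `total h f`: every non-pending index of `h` is in the domain of `f`. -/
def total (h : List Event) (f : ℕ → Option ℕ) : Prop :=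
  ∀ m, m < h.length → ¬ pi m h → ∃ k, f m = some k

/-- The event at index `m` of `h` is a return event. -/
def isRetAt (h : List Event) (m : ℕ) : Prop :=
  ∃ t o v, h[m]? = some (Event.ret t o v)

/-- The event at index `m` of `h` is an invocation event. -/
def isInvAt (h : List Event) (m : ℕ) : Prop :=
  ∃ t o v, h[m]? = some (Event.inv t o v)

/-- Linearizability ordering condition. -/
def lin (h : List Event) (f : ℕ → Option ℕ) : Prop :=
  ∀ m n km kn, f m = some km → f n = some kn → m < n →
    isRetAt h m → isInvAt h n → km < kn

/-- Sequential consistency ordering condition (per-thread order preserved). -/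
def sc (h : List Event) (f : ℕ → Option ℕ) : Prop :=
  ∀ m n km kn, f m = some km → f n = some kn → m < n →
    (∃ t o v o' v', h[m]? = some (Event.ret t o v) ∧ h[n]? = some (Event.inv t o' v')) →
    km < kn

/-- `qp m h`: index `m` is a quiescent point of `h`. -/
def qp (m : ℕ) (h : List Event) : Prop :=
  ∀ n, n ≤ m → ¬ pi n (h.take (m + 1))

/-- Quiescent consistency ordering condition (order across quiescent points preserved). -/
def qc (h : List Event) (f : ℕ → Option ℕ) : Prop :=
  ∀ m k n km kk kn, f m = some km → f k = some kk → f n = some kn →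
    m < k → k < n → qp k h → km < kn

/-- Legal sequential stack histories starting from stack contents `S`. -/
inductive LegalStack : List ℕ → List Event → Prop where
  | nil (S : List ℕ) : LegalStack S []
  | push (S : List ℕ) (t v : ℕ) (r : List Event) :
      LegalStack (v :: S) r →
      LegalStack S (Event.inv t Op.push (EVal.val v) :: Event.ret t Op.push EVal.bot :: r)
  | popEmpty (t : ℕ) (r : List Event) :
      LegalStack [] r →
      LegalStack [] (Event.inv t Op.pop EVal.bot :: Event.ret t Op.pop EVal.empty :: r)
  | pop (S : List ℕ) (t v : ℕ) (r : List Event) :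
      LegalStack S r →
      LegalStack (v :: S) (Event.inv t Op.pop EVal.bot :: Event.ret t Op.pop (EVal.val v) :: r)

theorem VMF.exists_of_mp {h : List Event} {f : ℕ → Option ℕ} (hVMF : VMF h f)
    (hTot : total h f) {m n : ℕ} (hmn : mp m n h) :
    ∃ k, f m = some k ∧ f n = some (k + 1) := by
  obtain ⟨hlt, hn, t, o, u, v, hm, hr, -⟩ := id hmn
  obtain ⟨k, hk⟩ := hTot m (hlt.trans hn) fun hp => hp.2 n hlt hn ⟨t, o, u, v, hm, hr⟩
  exact ⟨k, hk, hVMF.2.2.2.2 m n k hmn hk⟩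

theorem VMF.lt_of_lt {h : List Event} {f : ℕ → Option ℕ}
    (hAll : ∀ i, i < h.length → ∃ m n, mp m n h ∧ (i = m ∨ i = n))
    (hNonOverlap : ∀ m n m' n', mp m n h → mp m' n' h → ¬ (m = m' ∧ n = n') →
      n < m' ∨ n' < m)
    (hVMF : VMF h f) (hLin : lin h f) (hTot : total h f) {i j a b : ℕ}
    (hi : f i = some a) (hj : f j = some b) (hij : i < j) : a < b := by
  obtain ⟨m, n, hmn, him⟩ := hAll i (hVMF.1 _ _ hi)
  obtain ⟨m', n', hmn', hjm⟩ := hAll j (hVMF.1 _ _ hj)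
  obtain ⟨k, hk, hk1⟩ := hVMF.exists_of_mp hTot hmn
  obtain ⟨k', hk', hk1'⟩ := hVMF.exists_of_mp hTot hmn'
  have hlt := hmn.1
  have hlt' := hmn'.1
  by_cases heq : m = m' ∧ n = n'
  · grind
  · have hnm : n < m' := by
      have := hNonOverlap m n m' n' hmn hmn' heq
      omega
    obtain ⟨-, -, t, o, u, v, -, hr, -⟩ := hmn
    obtain ⟨-, -, t', o', u', v', hinv, -⟩ := hmn'
    have := hLin n m' _ _ hk1 hk' hnm ⟨t, o, v, hr⟩ ⟨t', o', u', hinv⟩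
    grind

/-- Rigidity of linearizable mappings on complete, pairwise non-overlapping histories:
a valid, total, linearizable mapping function must be the identity, and the mapped
history equals the original history. -/
theorem lin_mapping_rigid_on_sequential_histories
    (h : List Event) (f : ℕ → Option ℕ)
    (hAll : ∀ i, i < h.length → ∃ m n, mp m n h ∧ (i = m ∨ i = n))
    (hNonOverlap : ∀ m n m' n', mp m n h → mp m' n' h → ¬ (m = m' ∧ n = n') →
      n < m' ∨ n' < m)
    (hVMF : VMF h f) (hLin : lin h f) (hTot : total h f) :
    (∀ m, (∃ k, f m = some k) ↔ m < h.length) ∧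
    (∀ m, m < h.length → f m = some m) ∧
    (∀ g, mapped h f g → g = h) := by
  have hdom : ∀ m, m < h.length → ∃ k, f m = some k := by
    intro i hi
    obtain ⟨m, n, hmn, rfl | rfl⟩ := hAll i hi
    all_goals
      obtain ⟨k, hk, hk1⟩ := hVMF.exists_of_mp hTot hmn
      exact ⟨_, by assumption⟩
  have hmono : ∀ i j a b, f i = some a → f j = some b → i < j → a < b :=
    fun i j a b => hVMF.lt_of_lt hAll hNonOverlap hLin hTot
  have hid : ∀ m, m < h.length → f m = some m := by
    intro m
    induction m using Nat.strong_induction_on with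
    | _ m ih =>
      intro hm
      obtain ⟨N, hN⟩ := hVMF.2.1
      obtain ⟨k, hk⟩ := hdom m hm
      have hmk : m ≤ k := by
        rcases m with _ | p
        · omega
        · exact hmono p (p + 1) p k (ih p (by omega) (by omega)) hk (by omega)
      obtain ⟨i, hi⟩ := (hN m).2 (hmk.trans_lt ((hN k).1 ⟨m, hk⟩))
      rcases lt_trichotomy i m with hlt | rfl | hgt
      · have := ih i hlt (hlt.trans hm)
        grind
      · exact hi
      · have := hmono m i k m hk hi hgt
        omega
  refine ⟨fun m => ⟨fun ⟨k, hk⟩ => hVMF.1 m k hk, hdom m⟩, hid, fun g hg => ?_⟩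
  have hlen : ∀ k, k < g.length ↔ k < h.length := by
    intro k
    rw [hg.1 k]
    refine ⟨fun ⟨m, hm⟩ => ?_, fun hk => ⟨k, hid k hk⟩⟩
    have := hVMF.1 m k hm
    grind
  apply List.ext_getElem?
  intro k
  by_cases hk : k < h.length
  · exact hg.2 k k (hid k hk)
  · rw [List.getElem?_eq_none (not_lt.1 hk),
      List.getElem?_eq_none (not_lt.1 (mt (hlen k).1 hk))]
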